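/- arXiv:1205.6454 — 2 statements merged into one kernel-verified Lean document; each statement's English description precedes it below -/
import Mathlib

section
/- Affine-geometric Wirtinger inequality for convex curves: Let γ be a smooth strictly convex closed curve in ℝ² with support function s (s''+s > 0), parametrized by affine arc-length ds̄ = (s''+s)^{2/3} dθ, with affine curvature η and enclosed area A. Then for every smooth function F: γ → ℝ, ∫_γ F² η ds̄ ≤ (1/2)(∫_γ F ds̄)²/A + ∫_γ (dF/ds̄)² ds̄. -/
open Real intervalIntegral

/-- Picone's identity with the comparison function `cos (c (t - π/2))`, `0 ≤ c < 1`. -/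
lemma mul_integral_sq_le_integral_deriv_sq {w w' : ℝ → ℝ} (hw : ∀ t, HasDerivAt w (w' t) t)
    (hw' : Continuous w') (h0 : w 0 = 0) (hπ : w π = 0) {c : ℝ} (hc0 : 0 ≤ c) (hc1 : c < 1) :
    c ^ 2 * ∫ t in (0:ℝ)..π, w t ^ 2 ≤ ∫ t in (0:ℝ)..π, w' t ^ 2 := by
  have hwc : Continuous w := continuous_iff_continuousAt.2 fun t => (hw t).continuousAt
  have hcos : ∀ t ∈ Set.uIcc 0 π, 0 < cos (c * (t - π / 2)) := by
    intro t ht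
    rw [Set.uIcc_of_le pi_pos.le] at ht
    have hpi := pi_pos
    apply cos_pos_of_mem_Ioo
    constructor <;> nlinarith [ht.1, ht.2]
  have hcont : ContinuousOn (fun t => sin (c * (t - π / 2)) / cos (c * (t - π / 2)))
      (Set.uIcc 0 π) :=
    ContinuousOn.div (by fun_prop) (by fun_prop) fun t ht => (hcos t ht).ne'
  have hder : ∀ t ∈ Set.uIcc 0 π,
      HasDerivAt (fun t => -c * w t ^ 2 * (sin (c * (t - π / 2)) / cos (c * (t - π / 2))))
        (w' t ^ 2 - c ^ 2 * w t ^ 2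
          - (w' t + c * w t * (sin (c * (t - π / 2)) / cos (c * (t - π / 2)))) ^ 2) t := by
    intro t ht
    have hlin : HasDerivAt (fun t : ℝ => c * (t - π / 2)) (c * 1) t :=
      ((hasDerivAt_id t).sub_const _).const_mul c
    refine HasDerivAt.congr_deriv ((((hw t).pow 2).const_mul (-c)).mul (hlin.sin.div hlin.cos (hcos t ht).ne')) ?_
    have h1 := (hcos t ht).ne'
    simp only [Pi.pow_apply]
    generalize cos (c * (t - π / 2)) = C at h1 ⊢
    generalize sin (c * (t - π / 2)) = S
    field_simp
    push_cast
    ring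
  have hint : ContinuousOn (fun t => (w' t + c * w t *
      (sin (c * (t - π / 2)) / cos (c * (t - π / 2)))) ^ 2) (Set.uIcc 0 π) :=
    (hw'.continuousOn.add ((by fun_prop : ContinuousOn (fun t => c * w t) _).mul hcont)).pow 2
  have hint' : ContinuousOn (fun t => w' t ^ 2 - c ^ 2 * w t ^ 2) (Set.uIcc 0 π) := by fun_prop
  have hftc := integral_eq_sub_of_hasDerivAt hder (hint'.sub hint).intervalIntegrable
  rw [integral_sub hint'.intervalIntegrable hint.intervalIntegrable,
    integral_sub (Continuous.intervalIntegrable (by fun_prop) _ _)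
      (Continuous.intervalIntegrable (by fun_prop) _ _), integral_const_mul, h0, hπ] at hftc
  have hnonneg : 0 ≤ ∫ t in (0:ℝ)..π, (w' t + c * w t *
      (sin (c * (t - π / 2)) / cos (c * (t - π / 2)))) ^ 2 :=
    integral_nonneg pi_pos.le fun t _ => sq_nonneg _
  linarith

/-- Wirtinger's inequality on `[0, π]` with Dirichlet boundary conditions. -/
lemma integral_sq_le_integral_deriv_sq {w w' : ℝ → ℝ} (hw : ∀ t, HasDerivAt w (w' t) t)
    (hw' : Continuous w') (h0 : w 0 = 0) (hπ : w π = 0) :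
    ∫ t in (0:ℝ)..π, w t ^ 2 ≤ ∫ t in (0:ℝ)..π, w' t ^ 2 := by
  have hlim : Filter.Tendsto (fun c : ℝ => c ^ 2 * ∫ t in (0:ℝ)..π, w t ^ 2)
      (nhdsWithin 1 (Set.Iio 1)) (nhds (1 ^ 2 * ∫ t in (0:ℝ)..π, w t ^ 2)) :=
    ((by fun_prop : Continuous fun c : ℝ => c ^ 2 * ∫ t in (0:ℝ)..π, w t ^ 2).tendsto 1).mono_left
      nhdsWithin_le_nhds
  rw [one_pow, one_mul] at hlim
  refine le_of_tendsto hlim ?_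
  filter_upwards [Ioo_mem_nhdsLT (zero_lt_one (α := ℝ))] with c hc
  exact mul_integral_sq_le_integral_deriv_sq hw hw' h0 hπ hc.1.le hc.2

lemma integral_sq_sub_deriv_sq_nonpos {w w' : ℝ → ℝ} (hw : ∀ t, HasDerivAt w (w' t) t)
    (hw' : Continuous w') (h0 : w 0 = 0) (hπ : w π = 0) (h2π : w (2 * π) = 0) :
    ∫ t in (0:ℝ)..(2 * π), (w t ^ 2 - w' t ^ 2) ≤ 0 := by
  have hwc : Continuous w := continuous_iff_continuousAt.2 fun t => (hw t).continuousAt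
  have hi : ∀ a b : ℝ, IntervalIntegrable (fun t => w t ^ 2 - w' t ^ 2) MeasureTheory.volume a b :=
    fun a b => Continuous.intervalIntegrable (by fun_prop) a b
  have h1 := integral_sq_le_integral_deriv_sq hw hw' h0 hπ
  have h2 := integral_sq_le_integral_deriv_sq (w := fun t => w (t + π)) (w' := fun t => w' (t + π))
    (fun t => (hw (t + π)).comp_add_const t π) (by fun_prop) (by simpa using hπ)
    (by rw [← two_mul]; exact h2π)
  rw [integral_comp_add_right (fun t => w t ^ 2), integral_comp_add_right (fun t => w' t ^ 2),
    zero_add, ← two_mul] at h2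
  rw [← integral_add_adjacent_intervals (hi 0 π) (hi π (2 * π)),
    integral_sub (Continuous.intervalIntegrable (by fun_prop) _ _)
      (Continuous.intervalIntegrable (by fun_prop) _ _),
    integral_sub (Continuous.intervalIntegrable (by fun_prop) _ _)
      (Continuous.intervalIntegrable (by fun_prop) _ _)]
  linarith

lemma Function.Periodic.deriv_real {f : ℝ → ℝ} {c : ℝ} (hf : Function.Periodic f c) :
    Function.Periodic (deriv f) c := fun t => by
  rw [← deriv_comp_add_const, show (fun x => f (x + c)) = f from funext hf]

section SupportFunction

variable {s s' r : ℝ → ℝ}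

/-- Variation of constants for `s'' + s = r`. -/
lemma integral_mul_sin_sub (hs : ∀ t, HasDerivAt s (s' t) t)
    (hs' : ∀ t, HasDerivAt s' (r t - s t) t) (hr : Continuous r) (a b : ℝ) :
    ∫ t in a..b, r t * sin (b - t) = s b - s a * cos (b - a) - s' a * sin (b - a) := by
  have hd : ∀ t ∈ Set.uIcc a b, HasDerivAt (fun t => s' t * sin (b - t) + s t * cos (b - t))
      (r t * sin (b - t)) t := by
    intro t _
    have hl : HasDerivAt (fun t : ℝ => b - t) (-1) t := (hasDerivAt_id t).const_sub b
    refine HasDerivAt.congr_deriv (((hs' t).mul hl.sin).add ((hs t).mul hl.cos)) ?_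
    ring
  rw [integral_eq_sub_of_hasDerivAt hd (Continuous.intervalIntegrable (by fun_prop) _ _)]
  simp
  ring

lemma add_apply_pi_pos (hs : ∀ t, HasDerivAt s (s' t) t)
    (hs' : ∀ t, HasDerivAt s' (r t - s t) t) (hr : Continuous r) (hpos : ∀ t, 0 < r t) :
    0 < s 0 + s π := by
  have h := integral_mul_sin_sub hs hs' hr 0 π
  have h2 : 0 < ∫ t in (0:ℝ)..π, r t * sin (π - t) := by
    refine intervalIntegral_pos_of_pos_on (Continuous.intervalIntegrable (by fun_prop) _ _)
      (fun t ht => mul_pos (hpos t) ?_) pi_pos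
    rw [sin_pi_sub]
    exact sin_pos_of_mem_Ioo ht
  simp at h h2
  linarith

lemma sub_tangent_nonneg (hs : ∀ t, HasDerivAt s (s' t) t)
    (hs' : ∀ t, HasDerivAt s' (r t - s t) t) (hr : Continuous r) (hpos : ∀ t, 0 < r t)
    {b : ℝ} (hb : |b| ≤ π) : 0 ≤ s b - s 0 * cos b - s' 0 * sin b := by
  have h := integral_mul_sin_sub hs hs' hr 0 b
  rw [sub_zero] at h
  rw [← h]
  rw [abs_le] at hb
  rcases le_total 0 b with h0 | h0
  · refine integral_nonneg h0 fun t ht => mul_nonneg (hpos t).le ?_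
    exact sin_nonneg_of_nonneg_of_le_pi (by linarith [ht.2]) (by linarith [ht.1])
  · rw [integral_symm, ← integral_neg]
    refine integral_nonneg h0 fun t ht => ?_
    have : sin (b - t) ≤ 0 := sin_nonpos_of_nonpos_of_neg_pi_le (by linarith [ht.1])
      (by linarith [ht.2])
    nlinarith [hpos t]

lemma integral_support_mul_radius_pos (hs : ∀ t, HasDerivAt s (s' t) t)
    (hs' : ∀ t, HasDerivAt s' (r t - s t) t) (hr : Continuous r) (hpos : ∀ t, 0 < r t)
    (hper : Function.Periodic s (2 * π)) (hper' : Function.Periodic s' (2 * π)) :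
    0 < ∫ t in (0:ℝ)..(2 * π), s t * r t := by
  have hsc : Continuous s := continuous_iff_continuousAt.2 fun t => (hs t).continuousAt
  have hd : ∀ t ∈ Set.uIcc 0 (2 * π), HasDerivAt
      (fun t => s 0 * (s' t * cos t + s t * sin t) + s' 0 * (s' t * sin t - s t * cos t))
      (s t * r t - (s t - s 0 * cos t - s' 0 * sin t) * r t) t := by
    intro t _
    refine HasDerivAt.congr_deriv (((((hs' t).mul (hasDerivAt_cos t)).add ((hs t).mul (hasDerivAt_sin t))).const_mul
      (s 0)).add ((((hs' t).mul (hasDerivAt_sin t)).sub ((hs t).mul (hasDerivAt_cos t))).const_mul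
      (s' 0))) ?_
    ring
  have hftc := integral_eq_sub_of_hasDerivAt hd (Continuous.intervalIntegrable (by fun_prop) _ _)
  rw [integral_sub (Continuous.intervalIntegrable (by fun_prop) _ _)
      (Continuous.intervalIntegrable (by fun_prop) _ _), hper.eq, hper'.eq, cos_two_pi,
      sin_two_pi, cos_zero, sin_zero, sub_self, sub_eq_zero] at hftc
  rw [hftc]
  have hpi := pi_pos
  refine integral_pos (by positivity) (by fun_prop) (fun t ht => mul_nonneg ?_ (hpos t).le)
    ⟨π, ⟨hpi.le, by linarith⟩, mul_pos ?_ (hpos π)⟩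
  · rcases le_total t π with h | h
    · exact sub_tangent_nonneg hs hs' hr hpos (abs_le.2 ⟨by linarith [ht.1], h⟩)
    · have := sub_tangent_nonneg hs hs' hr hpos (b := t - 2 * π)
        (abs_le.2 ⟨by linarith, by linarith [ht.2]⟩)
      rwa [hper.sub_eq, cos_sub_two_pi, sin_sub_two_pi] at this
  · have := add_apply_pi_pos hs hs' hr hpos
    simp
    linarith

/-- Minkowski's inequality for mixed areas, for a convex curve and an arbitrary periodic
perturbation `u` of its support function. -/
lemma minkowski_inequality_support (hs : ∀ t, HasDerivAt s (s' t) t)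
    (hs' : ∀ t, HasDerivAt s' (r t - s t) t) (hr : Continuous r) (hpos : ∀ t, 0 < r t)
    (hper : Function.Periodic s (2 * π)) (hper' : Function.Periodic s' (2 * π))
    {u u' : ℝ → ℝ} (hu : ∀ t, HasDerivAt u (u' t) t) (hu' : Continuous u')
    (huper : Function.Periodic u (2 * π)) :
    ∫ t in (0:ℝ)..(2 * π), (u t ^ 2 - u' t ^ 2) ≤
      (∫ t in (0:ℝ)..(2 * π), u t * r t) ^ 2 / ∫ t in (0:ℝ)..(2 * π), s t * r t := by
  have hsc : Continuous s := continuous_iff_continuousAt.2 fun t => (hs t).continuousAt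
  have hsc' : Continuous s' := continuous_iff_continuousAt.2 fun t => (hs' t).continuousAt
  have huc : Continuous u := continuous_iff_continuousAt.2 fun t => (hu t).continuousAt
  have hwidth := add_apply_pi_pos hs hs' hr hpos
  obtain ⟨c, hc⟩ : ∃ c : ℝ, c * (s 0 + s π) = u 0 + u π :=
    ⟨(u 0 + u π) / (s 0 + s π), div_mul_cancel₀ _ hwidth.ne'⟩
  obtain ⟨a, ha⟩ : ∃ a : ℝ, a = u 0 - c * s 0 := ⟨_, rfl⟩
  have hle := integral_sq_sub_deriv_sq_nonpos (w := fun t => u t - c * s t - a * cos t)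
    (w' := fun t => u' t - c * s' t - a * -sin t)
    (fun t => ((hu t).sub ((hs t).const_mul c)).sub ((hasDerivAt_cos t).const_mul a))
    (by fun_prop) (by simp; linarith) (by simp; linarith)
    (by simp [hper.eq, huper.eq]; linarith)
  have hd : ∀ t ∈ Set.uIcc 0 (2 * π), HasDerivAt
      (fun t => 2 * c * (u t * s' t) - c ^ 2 * (s t * s' t) - 2 * a * (u t * sin t)
        + 2 * a * c * (s t * sin t) + a ^ 2 * (sin t * cos t))
      (((u t - c * s t - a * cos t) ^ 2 - (u' t - c * s' t - a * -sin t) ^ 2)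
        - ((u t ^ 2 - u' t ^ 2) - 2 * c * (u t * r t) + c ^ 2 * (s t * r t))) t := by
    intro t _
    refine HasDerivAt.congr_deriv (((((((hu t).mul (hs' t)).const_mul (2 * c)).sub
      (((hs t).mul (hs' t)).const_mul (c ^ 2))).sub
      (((hu t).mul (hasDerivAt_sin t)).const_mul (2 * a))).add
      (((hs t).mul (hasDerivAt_sin t)).const_mul (2 * a * c))).add
      (((hasDerivAt_sin t).mul (hasDerivAt_cos t)).const_mul (a ^ 2))) ?_
    ring
  have hexpand : ∫ t in (0:ℝ)..(2 * π),
        ((u t ^ 2 - u' t ^ 2) - 2 * c * (u t * r t) + c ^ 2 * (s t * r t))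
      = (∫ t in (0:ℝ)..(2 * π), (u t ^ 2 - u' t ^ 2))
        - 2 * c * (∫ t in (0:ℝ)..(2 * π), u t * r t)
        + c ^ 2 * ∫ t in (0:ℝ)..(2 * π), s t * r t := by
    rw [integral_add (Continuous.intervalIntegrable (by fun_prop) _ _)
        (Continuous.intervalIntegrable (by fun_prop) _ _),
      integral_sub (Continuous.intervalIntegrable (by fun_prop) _ _)
        (Continuous.intervalIntegrable (by fun_prop) _ _), integral_const_mul, integral_const_mul]
  have hftc := integral_eq_sub_of_hasDerivAt hd (Continuous.intervalIntegrable (by fun_prop) _ _)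
  rw [integral_sub (Continuous.intervalIntegrable (by fun_prop) _ _)
      (Continuous.intervalIntegrable (by fun_prop) _ _), hexpand, hper.eq, hper'.eq, huper.eq, cos_two_pi, sin_two_pi, cos_zero, sin_zero, sub_self,
    sub_eq_zero] at hftc
  have hA := integral_support_mul_radius_pos hs hs' hr hpos hper hper'
  rw [hftc] at hle
  rw [le_div_iff₀ hA]
  nlinarith [sq_nonneg ((∫ t in (0:ℝ)..(2 * π), u t * r t)
    - c * ∫ t in (0:ℝ)..(2 * π), s t * r t)]

end SupportFunction

/-- The affine curvature in terms of `q = r ^ (-1/3)`. -/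
lemma affine_curvature_eq {q q' q'' r x y : ℝ → ℝ} {D : (ℝ → ℝ) → (ℝ → ℝ)}
    (hD : ∀ u t, D u t = deriv u t * q t ^ 2) (hrq : ∀ t, r t * q t ^ 3 = 1)
    (hx : ∀ t, HasDerivAt x (-(r t * sin t)) t) (hy : ∀ t, HasDerivAt y (r t * cos t) t)
    (hq : ∀ t, HasDerivAt q (q' t) t) (hq' : ∀ t, HasDerivAt q' (q'' t) t) (t : ℝ) :
    D (D x) t * D (D (D y)) t - D (D y) t * D (D (D x)) t = q t ^ 3 * (q'' t + q t) := by
  have hq0 : ∀ t, q t ≠ 0 := fun t h => by simpa [h] using hrq t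
  have hx1 : D x = fun t => -(sin t / q t) := funext fun t => by
    rw [hD, (hx t).deriv]
    have := hq0 t
    field_simp
    linear_combination -(sin t) * hrq t
  have hy1 : D y = fun t => cos t / q t := funext fun t => by
    rw [hD, (hy t).deriv]
    have := hq0 t
    field_simp
    linear_combination (cos t) * hrq t
  have hx2 : D (D x) = fun t => q' t * sin t - q t * cos t := funext fun t => by
    have h : HasDerivAt (fun t => -(sin t / q t)) _ t :=
      ((hasDerivAt_sin t).div (hq t) (hq0 t)).neg
    rw [hD, hx1, h.deriv]
    have := hq0 t
    field_simp
    ring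
  have hy2 : D (D y) = fun t => -(q' t * cos t) - q t * sin t := funext fun t => by
    have h : HasDerivAt (fun t => cos t / q t) _ t := (hasDerivAt_cos t).div (hq t) (hq0 t)
    rw [hD, hy1, h.deriv]
    have := hq0 t
    field_simp
    ring
  have hx3 : D (D (D x)) t = q t ^ 2 * (q'' t + q t) * sin t := by
    have h : HasDerivAt (fun t => q' t * sin t - q t * cos t) _ t :=
      ((hq' t).mul (hasDerivAt_sin t)).sub ((hq t).mul (hasDerivAt_cos t))
    rw [hD, hx2, h.deriv]
    ring
  have hy3 : D (D (D y)) t = -(q t ^ 2 * (q'' t + q t) * cos t) := by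
    have h : HasDerivAt (fun t => -(q' t * cos t) - q t * sin t) _ t :=
      ((hq' t).mul (hasDerivAt_cos t)).neg.sub ((hq t).mul (hasDerivAt_sin t))
    rw [hD, hy2, h.deriv]
    ring
  rw [hx3, hy3, hx2, hy2]
  linear_combination (q t ^ 3 * (q'' t + q t)) * sin_sq_add_cos_sq t

/-- Affine-geometric Wirtinger inequality for smooth strictly convex closed
curves in the plane.  The curve is described by its support function `s`
(`r = s''+s > 0` is the radius of curvature as a function of the normal angle),
the affine arc-length element is `ds̄ = r^{2/3} dθ`, `A` is the enclosed area,
and `η` is the affine curvature, defined by `η = det[X_σσ, X_σσσ]` where `σ` is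
affine arc-length (so `d/dσ = r^{-2/3} d/dθ`) and `X` the position vector.
Then `∫ F² η ds̄ ≤ (1/2)(∫ F ds̄)²/A + ∫ (dF/ds̄)² ds̄` for every smooth `F`. -/
theorem affine_wirtinger_curves
    (s : ℝ → ℝ) (hs : ContDiff ℝ (⊤ : ℕ∞) s) (hsper : Function.Periodic s (2 * π))
    (r : ℝ → ℝ) (hr : ∀ θ, r θ = deriv (deriv s) θ + s θ)
    (hconv : ∀ θ, 0 < r θ)
    (x y : ℝ → ℝ)
    (hx : ∀ θ, x θ = s θ * cos θ - deriv s θ * sin θ)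
    (hy : ∀ θ, y θ = s θ * sin θ + deriv s θ * cos θ)
    (D : (ℝ → ℝ) → (ℝ → ℝ)) (hD : ∀ u θ, D u θ = deriv u θ / (r θ) ^ ((2:ℝ)/3))
    (η : ℝ → ℝ)
    (hη : ∀ θ, η θ = D (D x) θ * D (D (D y)) θ - D (D y) θ * D (D (D x)) θ)
    (A : ℝ) (hA : A = (1 / 2) * ∫ θ in (0:ℝ)..(2 * π), s θ * r θ)
    (F : ℝ → ℝ) (hF : ContDiff ℝ (⊤ : ℕ∞) F) (hFper : Function.Periodic F (2 * π)) :
    (∫ θ in (0:ℝ)..(2 * π), (F θ) ^ 2 * η θ * (r θ) ^ ((2:ℝ)/3))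
      ≤ (1 / 2) * (∫ θ in (0:ℝ)..(2 * π), F θ * (r θ) ^ ((2:ℝ)/3)) ^ 2 / A
        + ∫ θ in (0:ℝ)..(2 * π), (D F θ) ^ 2 * (r θ) ^ ((2:ℝ)/3) := by
  have hderiv : ∀ {f : ℝ → ℝ}, ContDiff ℝ (⊤ : ℕ∞) f →
      (∀ t, HasDerivAt f (deriv f t) t) ∧ ContDiff ℝ (⊤ : ℕ∞) (deriv f) := fun hf =>
    ⟨fun t => (hf.differentiable (by simp) t).hasDerivAt, (contDiff_infty_iff_deriv.1 hf).2⟩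
  obtain ⟨hs1, hs'⟩ := hderiv hs
  obtain ⟨hs2, hs''⟩ := hderiv hs'
  obtain ⟨hF1, hF'⟩ := hderiv hF
  have hrsm : ContDiff ℝ (⊤ : ℕ∞) r := by
    rw [show r = fun θ => deriv (deriv s) θ + s θ from funext hr]
    exact hs''.add hs
  have hrper : Function.Periodic r (2 * π) := fun t => by
    rw [hr, hr, hsper.deriv_real.deriv_real, hsper]
  have hs2' : ∀ t, HasDerivAt (deriv s) (r t - s t) t := fun t => by
    rw [hr, add_sub_cancel_right]
    exact hs2 t
  obtain ⟨q, hqdef⟩ : ∃ q : ℝ → ℝ, ∀ t, q t = r t ^ (-(1:ℝ) / 3) := ⟨_, fun _ => rfl⟩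
  have hqsm : ContDiff ℝ (⊤ : ℕ∞) q := by
    rw [show q = fun t => r t ^ (-(1:ℝ) / 3) from funext hqdef]
    exact hrsm.rpow_const_of_ne fun t => (hconv t).ne'
  have hqper : Function.Periodic q (2 * π) := fun t => by rw [hqdef, hqdef, hrper]
  obtain ⟨hq1, hq'⟩ := hderiv hqsm
  obtain ⟨hq2, hq''⟩ := hderiv hq'
  have hqpos : ∀ t, 0 < q t := fun t => hqdef t ▸ rpow_pos_of_pos (hconv t) _
  have hrq : ∀ t, r t * q t ^ 3 = 1 := fun t => by
    rw [hqdef, ← rpow_natCast, ← rpow_mul (hconv t).le]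
    norm_num [rpow_neg_one, (hconv t).ne']
  have hr23 : ∀ t, r t ^ ((2:ℝ) / 3) * q t ^ 2 = 1 := fun t => by
    rw [hqdef, ← rpow_natCast, ← rpow_mul (hconv t).le, ← rpow_add (hconv t)]
    norm_num
  have hr23' : ∀ t, r t ^ ((2:ℝ) / 3) = (q t ^ 2)⁻¹ := fun t =>
    eq_inv_of_mul_eq_one_left (hr23 t)
  have hη' : ∀ t, η t = q t ^ 3 * (deriv (deriv q) t + q t) := fun t => by
    rw [hη]
    refine affine_curvature_eq (fun u t => ?_) hrq (fun t => ?_) (fun t => ?_) hq1 hq2 t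
    · rw [hD, hr23', div_inv_eq_mul]
    · rw [show x = fun θ => s θ * cos θ - deriv s θ * sin θ from funext hx]
      refine HasDerivAt.congr_deriv (((hs1 t).mul (hasDerivAt_cos t)).sub ((hs2' t).mul (hasDerivAt_sin t))) ?_
      ring
    · rw [show y = fun θ => s θ * sin θ + deriv s θ * cos θ from funext hy]
      refine HasDerivAt.congr_deriv (((hs1 t).mul (hasDerivAt_sin t)).add ((hs2' t).mul (hasDerivAt_cos t))) ?_
      ring
  have hmink := minkowski_inequality_support hs1 hs2' hrsm.continuous hconv hsper
    hsper.deriv_real (u := fun t => F t * q t)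
    (u' := fun t => deriv F t * q t + F t * deriv q t)
    (fun t => (hF1 t).mul (hq1 t))
    (((hF'.mul hqsm).add (hF.mul hq')).continuous) (hFper.mul hqper)
  have hFc := hF.continuous
  have hFc' := hF'.continuous
  have hqc := hqsm.continuous
  have hqc' := hq'.continuous
  have hqc'' := hq''.continuous
  have e1 : ∀ t, F t ^ 2 * η t * r t ^ ((2:ℝ) / 3)
      = F t ^ 2 * (q t * (deriv (deriv q) t + q t)) := fun t => by
    rw [hη', hr23']
    have := (hqpos t).ne'
    field_simp
  have e2 : ∀ t, F t * r t ^ ((2:ℝ) / 3) = F t * q t * r t := fun t => by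
    rw [hr23']
    have := (hqpos t).ne'
    field_simp
    linear_combination -(F t) * hrq t
  have e3 : ∀ t, D F t ^ 2 * r t ^ ((2:ℝ) / 3) = (deriv F t * q t) ^ 2 := fun t => by
    rw [hD, hr23']
    have := (hqpos t).ne'
    field_simp
  simp only [e1, e2, e3]
  have hd : ∀ t ∈ Set.uIcc 0 (2 * π), HasDerivAt (fun t => F t ^ 2 * (q t * deriv q t))
      (F t ^ 2 * (q t * (deriv (deriv q) t + q t)) - ((deriv F t * q t) ^ 2
        + ((F t * q t) ^ 2 - (deriv F t * q t + F t * deriv q t) ^ 2))) t := by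
    intro t _
    refine HasDerivAt.congr_deriv (((hF1 t).pow 2).mul ((hq1 t).mul (hq2 t))) ?_
    simp only [Pi.pow_apply]
    push_cast
    ring
  have hftc := integral_eq_sub_of_hasDerivAt hd (Continuous.intervalIntegrable (by fun_prop) _ _)
  rw [integral_sub (Continuous.intervalIntegrable (by fun_prop) _ _)
      (Continuous.intervalIntegrable (by fun_prop) _ _),
    integral_add (Continuous.intervalIntegrable (by fun_prop) _ _)
      (Continuous.intervalIntegrable (by fun_prop) _ _), hFper.eq, hqper.eq,
    hqper.deriv_real.eq, sub_self, sub_eq_zero] at hftc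
  rw [hftc, add_comm, hA, mul_div_mul_left _ _ (by norm_num : (1 / 2 : ℝ) ≠ 0)]
  exact add_le_add_left hmink _
end

section
/- Isoperimetric-type consequence: for a smooth strictly convex planar curve with support function s (s''+s > 0), applying the affine Wirtinger inequality with F ≡ 1 yields ∫_γ η ds̄ ≤ (1/2)L²/A, where L = ∫₀^{2π}(s''+s)^{2/3}dθ is the affine length, η the affine curvature, and A the enclosed area. -/
open Real intervalIntegral

/-- **Wirtinger's inequality** on `[0, 2π]` for periodic functions of mean zero. -/
lemma wirtinger_of_integral_eq_zero {g g' : ℝ → ℝ} (hg : ∀ θ, HasDerivAt g (g' θ) θ)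
    (hg' : Continuous g') (hper : g (2 * π) = g 0) (hmean : ∫ θ in (0:ℝ)..(2 * π), g θ = 0) :
    ∫ θ in (0:ℝ)..(2 * π), g θ ^ 2 ≤ ∫ θ in (0:ℝ)..(2 * π), g' θ ^ 2 := by
  have hab : (0:ℝ) < 2 * π := by positivity
  have hgc : Continuous g := continuous_iff_continuousAt.2 fun θ ↦ (hg θ).continuousAt
  have hL2 : ∀ f : ℝ → ℝ, Continuous f → MeasureTheory.MemLp (fun θ ↦ (f θ : ℂ)) 2
      (MeasureTheory.volume.restrict (Set.Ioc 0 (2 * π))) := by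
    intro f hf
    have hc : Continuous fun θ ↦ (f θ : ℂ) := by fun_prop
    obtain ⟨C, hC⟩ := (isCompact_Icc (a := (0:ℝ)) (b := 2 * π)).exists_bound_of_continuousOn
      hc.continuousOn
    refine MeasureTheory.MemLp.of_bound hc.aestronglyMeasurable C ?_
    filter_upwards [MeasureTheory.ae_restrict_mem measurableSet_Ioc] with θ hθ
    exact hC θ (Set.Ioc_subset_Icc_self hθ)
  have h1 := hasSum_sq_fourierCoeffOn hab (hL2 g hgc)
  have h2 := hasSum_sq_fourierCoeffOn hab (hL2 g' hg')
  have hle := hasSum_le (fun n ↦ ?_) h1 h2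
  · have hpos : (0:ℝ) < (2 * π - 0)⁻¹ := by rw [sub_zero]; positivity
    simp only [Complex.norm_real, Real.norm_eq_abs, sq_abs, smul_eq_mul] at hle
    exact le_of_mul_le_mul_left hle hpos
  · rcases eq_or_ne n 0 with rfl | hn
    · have : fourierCoeffOn hab (fun θ ↦ (g θ : ℂ)) 0 = 0 := by
        rw [fourierCoeffOn_eq_integral]
        simp [intervalIntegral.integral_ofReal, hmean]
      rw [this]
      simp
    · rw [fourierCoeffOn_of_hasDerivAt hab hn (fun θ _ ↦ (hg θ).ofReal_comp)
        ((by fun_prop : Continuous fun θ ↦ (g' θ : ℂ)).intervalIntegrable _ _), hper]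
      have hn1 : (1:ℝ) ≤ |(n:ℝ)| := by exact_mod_cast Int.one_le_abs hn
      gcongr
      set c := fourierCoeffOn hab (fun θ ↦ (g' θ : ℂ)) n
      have : ‖(1 / (-2 * (π:ℂ) * Complex.I * n) * (fourier (-n) ((0:ℝ) : AddCircle (2 * π - 0)) *
          ((g 0 : ℂ) - g 0) - (((2 * π : ℝ) : ℂ) - ((0:ℝ) : ℂ)) * c))‖ = ‖c‖ / |(n:ℝ)| := by
        simp [abs_of_pos pi_pos]
        field_simp
      rw [this]
      exact div_le_self (norm_nonneg _) hn1

/-- The polarized form of twice the area, after integration by parts. -/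
lemma integral_mul_radius_eq {u u' v v' v'' : ℝ → ℝ}
    (hu : ∀ θ, HasDerivAt u (u' θ) θ) (hu' : Continuous u')
    (hv : ∀ θ, HasDerivAt v (v' θ) θ) (hv' : ∀ θ, HasDerivAt v' (v'' θ) θ)
    (hv'' : Continuous v'') (hper : u (2 * π) = u 0) (hper' : v' (2 * π) = v' 0) :
    ∫ θ in (0:ℝ)..(2 * π), u θ * (v'' θ + v θ) =
      ∫ θ in (0:ℝ)..(2 * π), (u θ * v θ - u' θ * v' θ) := by
  have huc : Continuous u := continuous_iff_continuousAt.2 fun θ ↦ (hu θ).continuousAt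
  have hvc : Continuous v := continuous_iff_continuousAt.2 fun θ ↦ (hv θ).continuousAt
  have hvc' : Continuous v' := continuous_iff_continuousAt.2 fun θ ↦ (hv' θ).continuousAt
  have key := integral_mul_deriv_eq_deriv_mul (a := 0) (b := 2 * π) (fun θ _ ↦ hu θ)
    (fun θ _ ↦ hv' θ) (hu'.intervalIntegrable _ _) (hv''.intervalIntegrable _ _)
  rw [hper, hper', sub_self, zero_sub] at key
  simp only [mul_add]
  rw [integral_add (Continuous.intervalIntegrable (by fun_prop) _ _)
    (Continuous.intervalIntegrable (by fun_prop) _ _),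
    integral_sub (Continuous.intervalIntegrable (by fun_prop) _ _)
    (Continuous.intervalIntegrable (by fun_prop) _ _), key]
  ring

/-- **Minkowski's inequality** for mixed areas in terms of support functions; only the
second function needs to have positive area. -/
lemma minkowski_mixed_area {f f' f'' s s' s'' : ℝ → ℝ}
    (hf : ∀ θ, HasDerivAt f (f' θ) θ) (hf' : ∀ θ, HasDerivAt f' (f'' θ) θ)
    (hf'' : Continuous f'') (hfp : f (2 * π) = f 0) (hfp' : f' (2 * π) = f' 0)
    (hs : ∀ θ, HasDerivAt s (s' θ) θ) (hs' : ∀ θ, HasDerivAt s' (s'' θ) θ)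
    (hs'' : Continuous s'') (hsp : s (2 * π) = s 0) (hsp' : s' (2 * π) = s' 0)
    (hmean : ∫ θ in (0:ℝ)..(2 * π), s θ ≠ 0)
    (harea : 0 < ∫ θ in (0:ℝ)..(2 * π), s θ * (s'' θ + s θ)) :
    (∫ θ in (0:ℝ)..(2 * π), f θ * (f'' θ + f θ)) * (∫ θ in (0:ℝ)..(2 * π), s θ * (s'' θ + s θ)) ≤
      (∫ θ in (0:ℝ)..(2 * π), f θ * (s'' θ + s θ)) ^ 2 := by
  have hfc : Continuous f := continuous_iff_continuousAt.2 fun θ ↦ (hf θ).continuousAt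
  have hfc' : Continuous f' := continuous_iff_continuousAt.2 fun θ ↦ (hf' θ).continuousAt
  have hsc : Continuous s := continuous_iff_continuousAt.2 fun θ ↦ (hs θ).continuousAt
  have hsc' : Continuous s' := continuous_iff_continuousAt.2 fun θ ↦ (hs' θ).continuousAt
  rw [integral_mul_radius_eq hs hsc' hs hs' hs'' hsp hsp'] at harea ⊢
  rw [integral_mul_radius_eq hf hfc' hf hf' hf'' hfp hfp',
    integral_mul_radius_eq hf hfc' hs hs' hs'' hfp hsp']
  set c := (∫ θ in (0:ℝ)..(2 * π), f θ) / ∫ θ in (0:ℝ)..(2 * π), s θ with hc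
  have hw := wirtinger_of_integral_eq_zero (g := fun θ ↦ f θ - c * s θ)
    (g' := fun θ ↦ f' θ - c * s' θ) (fun θ ↦ (hf θ).sub ((hs θ).const_mul c)) (by fun_prop)
    (by simp only [hfp, hsp]) (by
      rw [integral_sub (hfc.intervalIntegrable _ _)
        ((hsc.const_mul c).intervalIntegrable _ _), integral_const_mul, hc,
        div_mul_cancel₀ _ hmean, sub_self])
  rw [← sub_nonpos, ← integral_sub (Continuous.intervalIntegrable (by fun_prop) _ _)
    (Continuous.intervalIntegrable (by fun_prop) _ _)] at hw
  have hexp : ∀ θ, (f θ - c * s θ) ^ 2 - (f' θ - c * s' θ) ^ 2 =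
      (f θ * f θ - f' θ * f' θ) - (2 * c) * (f θ * s θ - f' θ * s' θ) +
        c ^ 2 * (s θ * s θ - s' θ * s' θ) := fun θ ↦ by ring
  simp only [hexp] at hw
  rw [integral_add (Continuous.intervalIntegrable (by fun_prop) _ _)
    (Continuous.intervalIntegrable (by fun_prop) _ _),
    integral_sub (Continuous.intervalIntegrable (by fun_prop) _ _)
    (Continuous.intervalIntegrable (by fun_prop) _ _), integral_const_mul,
    integral_const_mul] at hw
  set P := ∫ θ in (0:ℝ)..(2 * π), (f θ * f θ - f' θ * f' θ)
  set M := ∫ θ in (0:ℝ)..(2 * π), (f θ * s θ - f' θ * s' θ)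
  set S := ∫ θ in (0:ℝ)..(2 * π), (s θ * s θ - s' θ * s' θ)
  nlinarith [mul_le_mul_of_nonneg_right hw harea.le, sq_nonneg (M - c * S)]

/-- A closed curve with positive radius of curvature encloses positive area. -/
lemma area_pos_of_radius_pos {s s' s'' : ℝ → ℝ}
    (hs : ∀ θ, HasDerivAt s (s' θ) θ) (hs' : ∀ θ, HasDerivAt s' (s'' θ) θ)
    (hs'' : Continuous s'') (hsp : s (2 * π) = s 0) (hsp' : s' (2 * π) = s' 0)
    (hpos : ∀ θ, 0 < s'' θ + s θ) :
    0 < ∫ θ in (0:ℝ)..(2 * π), s θ * (s'' θ + s θ) := by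
  have hsc : Continuous s := continuous_iff_continuousAt.2 fun θ ↦ (hs θ).continuousAt
  have hsc' : Continuous s' := continuous_iff_continuousAt.2 fun θ ↦ (hs' θ).continuousAt
  have hG : ∀ θ φ, HasDerivAt (fun φ ↦ sin (θ - φ) * s' φ + cos (θ - φ) * s φ)
      (sin (θ - φ) * (s'' φ + s φ)) φ := by
    intro θ φ
    have h0 : HasDerivAt (fun φ ↦ θ - φ) (-1) φ := by
      simpa using (hasDerivAt_id φ).const_sub θ
    refine ((h0.sin.mul (hs' φ)).add (h0.cos.mul (hs φ))).congr_deriv ?_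
    ring
  have hlow : ∀ θ, 0 < θ → θ ≤ π → cos θ * s 0 + sin θ * s' 0 < s θ := by
    intro θ h0 h1
    have hm := strictMonoOn_of_deriv_pos (convex_Icc 0 θ)
      (continuous_iff_continuousAt.2 fun φ ↦ (hG θ φ).continuousAt).continuousOn (fun φ hφ ↦ by
        rw [interior_Icc] at hφ
        rw [(hG θ φ).deriv]
        exact mul_pos (sin_pos_of_pos_of_lt_pi (by linarith [hφ.2]) (by linarith [hφ.1])) (hpos φ))
    have := hm (Set.left_mem_Icc.2 h0.le) (Set.right_mem_Icc.2 h0.le) h0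
    simp at this
    linarith
  have hhigh : ∀ θ, π ≤ θ → θ ≤ 2 * π → cos θ * s 0 + sin θ * s' 0 ≤ s θ := by
    intro θ h0 h1
    have hm := antitoneOn_of_deriv_nonpos (convex_Icc θ (2 * π))
      (continuous_iff_continuousAt.2 fun φ ↦ (hG θ φ).continuousAt).continuousOn
      (fun φ _ ↦ (hG θ φ).differentiableAt.differentiableWithinAt) (fun φ hφ ↦ by
        rw [interior_Icc] at hφ
        rw [(hG θ φ).deriv]
        exact mul_nonpos_of_nonpos_of_nonneg (sin_nonpos_of_nonpos_of_neg_pi_le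
          (by linarith [hφ.1]) (by linarith [hφ.2])) (hpos φ).le)
    have := hm (Set.left_mem_Icc.2 h1) (Set.right_mem_Icc.2 h1) h1
    simp [hsp, hsp', sin_sub_two_pi, cos_sub_two_pi] at this
    linarith
  have hu : 0 < ∫ θ in (0:ℝ)..(2 * π),
      (s θ - (cos θ * s 0 + sin θ * s' 0)) * (s'' θ + s θ) := by
    refine integral_pos (by positivity) (by fun_prop) (fun θ hθ ↦ ?_)
      ⟨π, ⟨pi_pos.le, by linarith [pi_pos]⟩,
        mul_pos (sub_pos.2 (hlow π pi_pos le_rfl)) (hpos π)⟩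
    refine mul_nonneg (sub_nonneg.2 ?_) (hpos θ).le
    rcases le_total θ π with h | h
    · exact (hlow θ hθ.1 h).le
    · exact hhigh θ h hθ.2
  have hzero : ∫ θ in (0:ℝ)..(2 * π), (cos θ * s 0 + sin θ * s' 0) * (s'' θ + s θ) = 0 := by
    rw [integral_eq_sub_of_hasDerivAt
      (f := fun θ ↦ s 0 * (cos θ * s' θ + sin θ * s θ) + s' 0 * (sin θ * s' θ - cos θ * s θ))
      (fun θ _ ↦ ?_) (Continuous.intervalIntegrable (by fun_prop) _ _)]
    · simp [hsp, hsp']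
    · refine (((((hasDerivAt_cos θ).mul (hs' θ)).add ((hasDerivAt_sin θ).mul (hs θ))).const_mul
        (s 0)).add ((((hasDerivAt_sin θ).mul (hs' θ)).sub
          ((hasDerivAt_cos θ).mul (hs θ))).const_mul (s' 0))).congr_deriv ?_
      ring
  calc 0 < _ := hu
    _ = _ := by
      simp only [sub_mul _ _ (s'' _ + s _)]
      rw [integral_sub (Continuous.intervalIntegrable (by fun_prop) _ _)
        (Continuous.intervalIntegrable (by fun_prop) _ _), hzero, sub_zero]

/-- The `F ≡ 1` case of the affine-geometric Wirtinger inequality: for a smooth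
strictly convex closed planar curve with support function `s`, radius of
curvature `r = s''+s > 0`, affine length `L = ∫₀^{2π} r^{2/3} dθ`, affine
curvature `η` and enclosed area `A`, one has `∫ η ds̄ ≤ (1/2) L² / A`. -/
theorem affine_total_curvature_bound
    (s : ℝ → ℝ) (hs : ContDiff ℝ (⊤ : ℕ∞) s) (hsper : Function.Periodic s (2 * π))
    (r : ℝ → ℝ) (hr : ∀ θ, r θ = deriv (deriv s) θ + s θ)
    (hconv : ∀ θ, 0 < r θ)
    (x y : ℝ → ℝ)
    (hx : ∀ θ, x θ = s θ * cos θ - deriv s θ * sin θ)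
    (hy : ∀ θ, y θ = s θ * sin θ + deriv s θ * cos θ)
    (D : (ℝ → ℝ) → (ℝ → ℝ)) (hD : ∀ u θ, D u θ = deriv u θ / (r θ) ^ ((2:ℝ)/3))
    (η : ℝ → ℝ)
    (hη : ∀ θ, η θ = D (D x) θ * D (D (D y)) θ - D (D y) θ * D (D (D x)) θ)
    (L A : ℝ)
    (hL : L = ∫ θ in (0:ℝ)..(2 * π), (r θ) ^ ((2:ℝ)/3))
    (hA : A = (1 / 2) * ∫ θ in (0:ℝ)..(2 * π), s θ * r θ) :
    (∫ θ in (0:ℝ)..(2 * π), η θ * (r θ) ^ ((2:ℝ)/3)) ≤ (1 / 2) * L ^ 2 / A := by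
  have hs1 : ContDiff ℝ (⊤ : ℕ∞) (deriv s) := (contDiff_infty_iff_deriv.1 hs).2
  have hs2 : ContDiff ℝ (⊤ : ℕ∞) (deriv (deriv s)) := (contDiff_infty_iff_deriv.1 hs1).2
  have hds : ∀ θ, HasDerivAt s (deriv s θ) θ :=
    fun θ ↦ (hs.differentiable (by simp) θ).hasDerivAt
  have hds1 : ∀ θ, HasDerivAt (deriv s) (deriv (deriv s) θ) θ :=
    fun θ ↦ (hs1.differentiable (by simp) θ).hasDerivAt
  have hper1 : ∀ f : ℝ → ℝ, Function.Periodic f (2 * π) →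
      Function.Periodic (deriv f) (2 * π) := by
    intro f hf θ
    rw [← deriv_comp_add_const, funext hf]
  have hrper : Function.Periodic r (2 * π) := fun θ ↦ by
    rw [hr, hr, hsper, hper1 _ (hper1 _ hsper)]
  obtain rfl : r = fun θ ↦ deriv (deriv s) θ + s θ := funext hr
  set r : ℝ → ℝ := fun θ ↦ deriv (deriv s) θ + s θ with hrdef
  have hrs : ContDiff ℝ (⊤ : ℕ∞) r := hs2.add hs
  obtain ⟨w, hw⟩ : ∃ w : ℝ → ℝ, w = fun θ ↦ r θ ^ (-(1 / 3) : ℝ) := ⟨_, rfl⟩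
  have hws : ContDiff ℝ (⊤ : ℕ∞) w := by
    rw [hw]
    exact hrs.rpow_const_of_ne fun θ ↦ (hconv θ).ne'
  have hws1 : ContDiff ℝ (⊤ : ℕ∞) (deriv w) := (contDiff_infty_iff_deriv.1 hws).2
  have hws2 : ContDiff ℝ (⊤ : ℕ∞) (deriv (deriv w)) := (contDiff_infty_iff_deriv.1 hws1).2
  have hdw : ∀ θ, HasDerivAt w (deriv w θ) θ :=
    fun θ ↦ (hws.differentiable (by simp) θ).hasDerivAt
  have hdw1 : ∀ θ, HasDerivAt (deriv w) (deriv (deriv w) θ) θ :=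
    fun θ ↦ (hws1.differentiable (by simp) θ).hasDerivAt
  have hwper : Function.Periodic w (2 * π) := fun θ ↦ by simp only [hw, hrper θ]
  have hwpos : ∀ θ, 0 < w θ := fun θ ↦ by rw [hw]; exact rpow_pos_of_pos (hconv θ) _
  have hpow : ∀ θ, r θ ^ ((2:ℝ) / 3) = (w θ ^ 2)⁻¹ := fun θ ↦ by
    rw [hw, ← rpow_natCast, ← rpow_mul (hconv θ).le, ← rpow_neg (hconv θ).le]
    norm_num
  have hrw : ∀ θ, r θ = (w θ ^ 3)⁻¹ := fun θ ↦ by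
    rw [hw, ← rpow_natCast, ← rpow_mul (hconv θ).le, ← rpow_neg (hconv θ).le]
    norm_num
  have hD' : ∀ (u u' v : ℝ → ℝ), (∀ θ, HasDerivAt u (u' θ) θ) → (∀ θ, u' θ * w θ ^ 2 = v θ) →
      D u = v := by
    intro u u' v hu huv
    funext θ
    rw [hD, hpow, (hu θ).deriv, div_inv_eq_mul, huv]
  have hDx : D x = fun θ ↦ -((w θ)⁻¹ * sin θ) := by
    obtain rfl := funext hx
    refine hD' _ (fun θ ↦ -(r θ * sin θ)) _ (fun θ ↦ ?_) fun θ ↦ ?_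
    · refine (((hds θ).mul (hasDerivAt_cos θ)).sub
        ((hds1 θ).mul (hasDerivAt_sin θ))).congr_deriv ?_
      simp only [hrdef]
      ring
    · have := (hwpos θ).ne'
      rw [hrw]
      field_simp
  have hDy : D y = fun θ ↦ (w θ)⁻¹ * cos θ := by
    obtain rfl := funext hy
    refine hD' _ (fun θ ↦ r θ * cos θ) _ (fun θ ↦ ?_) fun θ ↦ ?_
    · refine (((hds θ).mul (hasDerivAt_sin θ)).add
        ((hds1 θ).mul (hasDerivAt_cos θ))).congr_deriv ?_
      simp only [hrdef]
      ring
    · have := (hwpos θ).ne'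
      rw [hrw]
      field_simp
  have hDDx : D (D x) = fun θ ↦ deriv w θ * sin θ - w θ * cos θ := by
    rw [hDx]
    refine hD' _ _ _ (fun θ ↦ (((hdw θ).inv (hwpos θ).ne').mul (hasDerivAt_sin θ)).neg) fun θ ↦ ?_
    have := (hwpos θ).ne'
    simp only [Pi.inv_apply]
    field_simp
    ring
  have hDDy : D (D y) = fun θ ↦ -(deriv w θ * cos θ + w θ * sin θ) := by
    rw [hDy]
    refine hD' _ _ _ (fun θ ↦ ((hdw θ).inv (hwpos θ).ne').mul (hasDerivAt_cos θ)) fun θ ↦ ?_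
    have := (hwpos θ).ne'
    simp only [Pi.inv_apply]
    field_simp
    ring
  have hDDDx : D (D (D x)) = fun θ ↦ w θ ^ 2 * (deriv (deriv w) θ + w θ) * sin θ := by
    rw [hDDx]
    refine hD' _ _ _ (fun θ ↦ ((hdw1 θ).mul (hasDerivAt_sin θ)).sub
      ((hdw θ).mul (hasDerivAt_cos θ))) fun θ ↦ ?_
    ring
  have hDDDy : D (D (D y)) = fun θ ↦ -(w θ ^ 2 * (deriv (deriv w) θ + w θ) * cos θ) := by
    rw [hDDy]
    refine hD' _ _ _ (fun θ ↦ (((hdw1 θ).mul (hasDerivAt_cos θ)).add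
      ((hdw θ).mul (hasDerivAt_sin θ))).neg) fun θ ↦ ?_
    ring
  have hηint : ∀ θ, η θ * r θ ^ ((2:ℝ) / 3) = w θ * (deriv (deriv w) θ + w θ) := by
    intro θ
    have hη' : η θ = w θ ^ 3 * (deriv (deriv w) θ + w θ) := by
      rw [hη, hDDDx, hDDDy, hDDx, hDDy]
      linear_combination w θ ^ 3 * (deriv (deriv w) θ + w θ) * sin_sq_add_cos_sq θ
    have := (hwpos θ).ne'
    rw [hη', hpow]
    field_simp
  have hmix : ∀ θ, r θ ^ ((2:ℝ) / 3) = w θ * r θ := by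
    intro θ
    have := (hwpos θ).ne'
    rw [hpow, hrw]
    field_simp
  have hp {f : ℝ → ℝ} (hf : Function.Periodic f (2 * π)) : f (2 * π) = f 0 := by
    simpa using hf 0
  have harea : 0 < ∫ θ in (0:ℝ)..(2 * π), s θ * r θ :=
    area_pos_of_radius_pos hds hds1 hs2.continuous (hp hsper) (hp (hper1 s hsper)) hconv
  have hmean : ∫ θ in (0:ℝ)..(2 * π), s θ ≠ 0 := by
    have h1 : 0 < ∫ θ in (0:ℝ)..(2 * π), r θ :=
      intervalIntegral_pos_of_pos (hrs.continuous.intervalIntegrable _ _) hconv (by positivity)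
    have h2 := integral_mul_radius_eq (u := fun _ ↦ 1) (u' := fun _ ↦ 0)
      (fun θ ↦ hasDerivAt_const θ 1) continuous_const hds hds1 hs2.continuous rfl
      (hp (hper1 s hsper))
    simp only [one_mul, zero_mul, sub_zero] at h2
    rw [← h2]
    exact h1.ne'
  have key := minkowski_mixed_area hdw hdw1 hws2.continuous (hp hwper) (hp (hper1 w hwper))
    hds hds1 hs2.continuous (hp hsper) (hp (hper1 s hsper)) hmean harea
  simp only [hηint]
  simp only [hmix] at hL
  rw [hA, le_div_iff₀ (by positivity), hL]
  linarith
end
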